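/- arXiv:1905.09223 — 2 statements merged into one kernel-verified Lean document; each statement's English description precedes it below -/
import Mathlib

section
/- Let α be a real number with α − max G ∉ {0, −1, −2, …} and assume Ω_G(n) ≠ 0 for every integer n ≥ 0. Let Q(x) = Σ_{k=u}^{v} σ_k x^k be a polynomial with integers 0 ≤ u ≤ v and σ_u ≠ 0, σ_v ≠ 0. If there exists ĝ ∈ G with ĝ − u ≥ 0 and ĝ − u ∉ G, then there do not exist integers s ≤ r and real numbers γ_{n,i} (n ≥ 0, s ≤ i ≤ r), with γ_{n,s} ≠ 0 and γ_{n,r} ≠ 0 for all n, such that Q(x)·q_n(x) = Σ_{i=s}^{r} γ_{n,i}·q_{n+i}(x) for all n ≥ max{0, −s} (with the convention q_k = 0 for k < 0). -/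
open Polynomial Finset

/-- Pochhammer symbol `(a)_l = a (a+1) ⋯ (a+l-1)`, with `(a)_0 = 1`. -/
noncomputable def poch (a : ℝ) (l : ℕ) : ℝ := ∏ t ∈ Finset.range l, (a + t)

/-- Generalized binomial coefficient `binom (n+α, n−j) = (α+j+1)⋯(α+n)/(n−j)!`. -/
noncomputable def genBinom (α : ℝ) (n j : ℕ) : ℝ :=
  (∏ t ∈ Finset.Ico (j + 1) (n + 1), (α + t)) / (Nat.factorial (n - j) : ℝ)

/-- Laguerre polynomial `L_n^α(x) = Σ_{j=0}^n ((−x)^j/j!)·binom(n+α, n−j)`. -/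
noncomputable def laguerre (α : ℝ) (n : ℕ) : Polynomial ℝ :=
  ∑ j ∈ Finset.range (n + 1),
    Polynomial.C ((-1 : ℝ) ^ j / (Nat.factorial j : ℝ) * genBinom α n j) * Polynomial.X ^ j

/-- Laguerre polynomials indexed by `ℤ`, with the convention `L_u^α = 0` for `u < 0`. -/
noncomputable def laguerreZ (α : ℝ) (n : ℤ) : Polynomial ℝ :=
  if n < 0 then 0 else laguerre α n.toNat

/-- The polynomial `binom (x+l, l) = (x+1)(x+2)⋯(x+l)/l!`. -/
noncomputable def binomPoly (l : ℕ) : Polynomial ℝ :=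
  Polynomial.C ((Nat.factorial l : ℝ)⁻¹) *
    ∏ t ∈ Finset.range l, (Polynomial.X + Polynomial.C ((t : ℝ) + 1))

/-- The Casoratian `Ω_G(x) = det (R_{g_l}(x−j))_{l,j=1,…,m}`. -/
noncomputable def casoratian {m : ℕ} (R : Fin m → Polynomial ℝ) (x : ℝ) : ℝ :=
  Matrix.det (Matrix.of fun l j : Fin m => (R l).eval (x - ((j : ℕ) + 1)))

/-- The maximum of the finite set `G` (given by the values of `g`). -/
noncomputable def Gmax {m : ℕ} (g : Fin m → ℕ) : ℕ := Finset.univ.sup g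

/-- The polynomial `q_n`, defined as an `(m+1)×(m+1)` determinant whose first row is
`(L_n^α(x), …, L_{n−m}^α(x))` and whose `(h+1)`-th row is `(R_{g_h}(n), …, R_{g_h}(n−m))`. -/
noncomputable def qpoly (α : ℝ) {m : ℕ} (R : Fin m → Polynomial ℝ) (n : ℤ) : Polynomial ℝ :=
  Matrix.det (Matrix.of fun i j : Fin (m + 1) =>
    if h : (i : ℕ) = 0 then laguerreZ α (n - (j : ℕ))
    else Polynomial.C ((R ⟨(i : ℕ) - 1, by have := i.isLt; omega⟩).eval ((n : ℝ) - ((j : ℕ) : ℝ))))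

/-- `q_n` extended by the convention `q_k = 0` for `k < 0`. -/
noncomputable def qZ (α : ℝ) {m : ℕ} (R : Fin m → Polynomial ℝ) (n : ℤ) : Polynomial ℝ :=
  if n < 0 then 0 else qpoly α R n

/-- `momFun β p k = L_β(p(x)·x^k)`, where `L_β` is the moment functional on Laurent
polynomials determined by `L_β(x^j) = Γ(β+j+1)`. -/
noncomputable def momFun (β : ℝ) (p : Polynomial ℝ) (k : ℤ) : ℝ :=
  ∑ t ∈ Finset.range (p.natDegree + 1), p.coeff t * Real.Gamma (β + t + k + 1)

/-- The bilinear form `⟨p, q⟩ = L_{α−m}(p·q) + Σ_{i=0}^{m−1} (q^{(i)}(0)/i!)·L_α(p·U_i)`,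
where `U_i(x) = Σ_{g∈G} ( −x^{i−m}/m + κ_i^g·Σ_{l=0}^g (α−l)_l w_l^g x^{−l−1} )`. -/
noncomputable def bilin (α : ℝ) {m : ℕ} (g : Fin m → ℕ) (κ : ℕ → Fin m → ℝ)
    (w : Fin m → ℕ → ℝ) (p q : Polynomial ℝ) : ℝ :=
  momFun (α - m) (p * q) 0 +
    ∑ i ∈ Finset.range m,
      (Polynomial.eval 0 (Polynomial.derivative^[i] q) / (Nat.factorial i : ℝ)) *
        (∑ h : Fin m,
          (-(1 / (m : ℝ)) * momFun α p ((i : ℤ) - (m : ℤ)) +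
            κ i h * ∑ l ∈ Finset.range (g h + 1),
              poch (α - l) l * w h l * momFun α p (-((l : ℤ) + 1))))

/-- The bilinear form `⟨p, q⟩_ξ` (case `α` a positive integer with `α ≤ max G`). -/
noncomputable def bilinXi (α : ℕ) {m : ℕ} (g : Fin m → ℕ) (κ : ℕ → Fin m → ℝ)
    (w : Fin m → ℕ → ℝ) (p q : Polynomial ℝ) : ℝ :=
  momFun ((α - m : ℕ) : ℝ) (p * Polynomial.derivative^[m - α] q) 0 +
    ∑ i ∈ Finset.range m,
      (Polynomial.eval 0 (Polynomial.derivative^[i] q) / (Nat.factorial i : ℝ)) *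
        (∑ h : Fin m,
          (poch ((i : ℝ) - m + α + 1) (m - α) * (-(1 / (m : ℝ))) * momFun α p ((i : ℤ) - (m : ℤ)) +
            κ i h * ∑ l ∈ Finset.range (if g h < α then g h + 1 else α),
              poch ((α : ℝ) - l) l * w h l * momFun α p (-((l : ℤ) + 1)))) +
    Real.Gamma α *
      ∑ i ∈ Finset.range m,
        (Polynomial.eval 0 (Polynomial.derivative^[i] q) / (Nat.factorial i : ℝ)) *
          ∑ h ∈ Finset.univ.filter (fun h : Fin m => α ≤ g h),
            κ i h *
              ∑ j ∈ Finset.range (g h - α + 1),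
                (Polynomial.eval 0 (Polynomial.derivative^[j] p) / (Nat.factorial j : ℝ)) *
                  ∑ l ∈ Finset.Icc (α + j) (g h), poch ((α : ℝ) - l) j * w h l

lemma lag_coeff (α : ℝ) (n j : ℕ) : (laguerre α n).coeff j =
    if j ≤ n then (-1 : ℝ) ^ j / (Nat.factorial j : ℝ) * genBinom α n j else 0 := by
  unfold laguerre
  simp only [Polynomial.finsetSum_coeff, Polynomial.coeff_C_mul, Polynomial.coeff_X_pow]
  simp [Finset.sum_ite_eq, Nat.lt_succ_iff]

lemma lag_degree (α : ℝ) (n : ℕ) : (laguerre α n).degree = n := by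
  have h1 : (laguerre α n).coeff n ≠ 0 := by
    rw [lag_coeff]; simp [genBinom, Nat.factorial_ne_zero]
  apply le_antisymm
  · rw [Polynomial.degree_le_iff_coeff_zero]
    intro k hk
    rw [lag_coeff, if_neg]
    have : n < k := by exact_mod_cast hk
    omega
  · exact Polynomial.le_degree_of_ne_zero h1

noncomputable def lagSeq (α : ℝ) : Polynomial.Sequence ℝ := ⟨laguerre α, lag_degree α⟩

lemma exists_fun (α : ℝ) (f : ℕ → ℝ) : ∃ φ : ℝ[X] →ₗ[ℝ] ℝ, ∀ k, φ (laguerre α k) = f k := by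
  have hu : ∀ i, IsUnit ((lagSeq α) i).leadingCoeff := by
    intro i
    rw [isUnit_iff_ne_zero, Polynomial.leadingCoeff_ne_zero]
    exact (lagSeq α).ne_zero i
  refine ⟨((lagSeq α).basis hu).constr ℝ f, fun k => ?_⟩
  have := ((lagSeq α).basis hu).constr_basis ℝ f k
  rw [Polynomial.Sequence.basis_eq_self] at this
  exact this

lemma lag_rec (α : ℝ) (k : ℕ) : X * laguerre α (k + 1) =
    C (-((k : ℝ) + 2)) * laguerre α (k + 2) + C (2 * (k : ℝ) + α + 3) * laguerre α (k + 1)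
      - C ((k : ℝ) + 1 + α) * laguerre α k := by
  ext j
  rcases j with _ | j
  · simp only [Polynomial.coeff_add, Polynomial.coeff_sub, Polynomial.coeff_C_mul, lag_coeff,
      Polynomial.mul_coeff_zero, Polynomial.coeff_X_zero, Polynomial.coeff_C_zero, zero_mul, genBinom, zero_le, if_true]
    rw [Finset.prod_Ico_succ_top (b := k + 2) (by omega),
      Finset.prod_Ico_succ_top (b := k + 1) (by omega)]
    simp only [Nat.sub_zero, Nat.factorial_succ]
    have : (Nat.factorial k : ℝ) ≠ 0 := by positivity
    push_cast
    field_simp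
    ring
  · simp only [Polynomial.coeff_add, Polynomial.coeff_sub, Polynomial.coeff_C_mul, lag_coeff,
      Polynomial.coeff_X_mul, genBinom]
    rcases lt_trichotomy j k with h | h | h
    · obtain ⟨e, rfl⟩ : ∃ e, k = j + 1 + e := ⟨k - (j + 1), by omega⟩
      rw [if_pos (by omega), if_pos (by omega), if_pos (by omega), if_pos (by omega)]
      rw [Finset.prod_Ico_succ_top (a := j + 1 + 1) (b := j + 1 + e + 2) (by omega),
        Finset.prod_Ico_succ_top (a := j + 1 + 1) (b := j + 1 + e + 1) (by omega),
        Finset.prod_eq_prod_Ico_succ_bot (a := j + 1) (by omega),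
        Finset.prod_Ico_succ_top (a := j + 1 + 1) (b := j + 1 + e + 1) (by omega),
        show j + 1 + e + 2 - (j + 1) = e + 2 by omega,
        show j + 1 + e + 1 - (j + 1) = e + 1 by omega,
        show j + 1 + e - (j + 1) = e by omega,
        show j + 1 + e + 1 - j = e + 2 by omega]
      generalize ∏ t ∈ Finset.Ico (j + 1 + 1) (j + 1 + e + 1), (α + (t : ℝ)) = p
      simp only [Nat.factorial_succ, pow_succ]
      have : (Nat.factorial j : ℝ) ≠ 0 := by positivity
      have : (Nat.factorial e : ℝ) ≠ 0 := by positivity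
      push_cast
      field_simp
      ring
    · subst h
      rw [if_pos (by omega), if_pos (by omega), if_pos (by omega), if_neg (by omega)]
      rw [show j + 2 - (j + 1) = 1 by omega, show j + 1 - (j + 1) = 0 by omega,
        show j + 1 - j = 1 by omega]
      have : (Nat.factorial j : ℝ) ≠ 0 := by positivity
      simp [Nat.factorial_succ, pow_succ]
      field_simp
      ring
    · by_cases h2 : j = k + 1
      · subst h2
        rw [if_pos (by omega), if_pos (by omega), if_neg (by omega), if_neg (by omega)]
        have : (Nat.factorial k : ℝ) ≠ 0 := by positivity
        simp [Nat.factorial_succ, pow_succ]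
        field_simp
        ring
      · rw [if_neg (by omega), if_neg (by omega), if_neg (by omega), if_neg (by omega)]
        simp

/-- The difference operator corresponding to multiplication by `x`. -/
noncomputable def dop (α : ℝ) : ℝ[X] →ₗ[ℝ] ℝ[X] where
  toFun P := -(X + 1) * P.comp (X + 1) + (2 * X + C (α + 1)) * P - (X + C α) * P.comp (X - 1)
  map_add' P Q := by simp only [Polynomial.add_comp]; ring
  map_smul' c P := by
    simp only [Polynomial.smul_eq_C_mul, Polynomial.mul_comp, Polynomial.C_comp, RingHom.id_apply]
    ring

lemma dop_eval (α : ℝ) (P : ℝ[X]) (x : ℝ) : (dop α P).eval x =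
    -(x + 1) * P.eval (x + 1) + (2 * x + (α + 1)) * P.eval x - (x + α) * P.eval (x - 1) := by
  simp [dop, Polynomial.eval_comp]

noncomputable def epoly (l : ℕ) : ℝ[X] := ∏ t ∈ Finset.range l, (X + C ((t : ℝ) + 1))

lemma epoly_monic (l : ℕ) : (epoly l).Monic :=
  Polynomial.monic_prod_of_monic _ _ fun _ _ => Polynomial.monic_X_add_C _

lemma epoly_natDegree (l : ℕ) : (epoly l).natDegree = l := by
  unfold epoly
  rw [Polynomial.natDegree_prod_of_monic _ _ fun _ _ => Polynomial.monic_X_add_C _]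
  simp only [Polynomial.natDegree_X_add_C]
  simp

lemma dop_epoly (α : ℝ) (l : ℕ) :
    dop α (epoly (l + 1)) = C (((l : ℝ) + 1) * (α - (l + 1))) * epoly l := by
  apply Polynomial.funext
  intro x
  rw [dop_eval]
  have e : ∀ l x, (epoly l).eval x = ∏ t ∈ Finset.range l, (x + ((t : ℝ) + 1)) := by
    intro l x; simp [epoly, Polynomial.eval_prod]
  have h0 : (epoly (l + 1)).eval x = (epoly l).eval x * (x + (l + 1)) := by
    rw [e, e, Finset.prod_range_succ]
  have h1 : (epoly (l + 1)).eval (x - 1) = (epoly l).eval x * x := by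
    rw [e, e, Finset.prod_range_succ']
    congr 1
    · apply Finset.prod_congr rfl; intro t _; push_cast; ring
    · push_cast; ring
  have h2 : (x + 1) * (epoly (l + 1)).eval (x + 1) = (epoly l).eval x * (x + (l + 1)) * (x + (l + 2)) := by
    have : (epoly (l + 2)).eval x = (x + 1) * (epoly (l + 1)).eval (x + 1) := by
      rw [e, e, Finset.prod_range_succ', mul_comm]
      congr 1
      · push_cast; ring
      · apply Finset.prod_congr rfl; intro t _; push_cast; ring
    rw [← this, ← h0, e, e, Finset.prod_range_succ]
    congr 1; push_cast; ring
  rw [neg_mul, h2, h0, h1]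
  simp only [Polynomial.eval_mul, Polynomial.eval_C]
  ring

lemma dop_C (α c : ℝ) : dop α (C c) = 0 := by
  apply Polynomial.funext
  intro x
  rw [dop_eval]; simp; ring

lemma dop_deg (α : ℝ) (d : ℕ) : ∀ P : ℝ[X], P.natDegree ≤ d →
    (dop α P).natDegree ≤ d - 1 ∧ (dop α P).coeff (d - 1) = d * (α - d) * P.coeff d := by
  induction d with
  | zero =>
    intro P hP
    rw [Polynomial.eq_C_of_natDegree_le_zero hP, dop_C]; simp
  | succ d ih =>
    intro P hP
    obtain ⟨P', hP', hPP⟩ : ∃ P' : ℝ[X], P'.natDegree ≤ d ∧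
        P = C (P.coeff (d + 1)) * epoly (d + 1) + P' := by
      refine ⟨P - C (P.coeff (d + 1)) * epoly (d + 1), ?_, by ring⟩
      rw [Polynomial.natDegree_le_iff_coeff_eq_zero]
      intro N hN
      have hm : (epoly (d + 1)).coeff (d + 1) = 1 := by
        have := epoly_monic (d + 1)
        rwa [Polynomial.Monic, Polynomial.leadingCoeff, epoly_natDegree] at this
      rw [Polynomial.coeff_sub, Polynomial.coeff_C_mul]
      rcases eq_or_lt_of_le (Nat.succ_le_of_lt hN) with h | h
      · rw [← h, Nat.succ_eq_add_one, hm]; ring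
      · rw [Polynomial.coeff_eq_zero_of_natDegree_lt (p := P) (by omega),
          Polynomial.coeff_eq_zero_of_natDegree_lt (p := epoly _) (by rw [epoly_natDegree]; omega)]
        ring
    have key : dop α P = C (P.coeff (d + 1) * ((d + 1) * (α - (d + 1)))) * epoly d + dop α P' := by
      conv_lhs => rw [hPP]
      rw [map_add, ← Polynomial.smul_eq_C_mul, map_smul, dop_epoly, Polynomial.smul_eq_C_mul,
        ← mul_assoc, ← Polynomial.C_mul]
    have hP0 : (dop α P').coeff d = 0 := by
      rcases d with _ | d
      · rw [Polynomial.eq_C_of_natDegree_le_zero hP', dop_C]; simp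
      · apply Polynomial.coeff_eq_zero_of_natDegree_lt
        have := (ih P' hP').1
        omega
    have hm : (epoly d).coeff d = 1 := by
      have := epoly_monic d
      rwa [Polynomial.Monic, Polynomial.leadingCoeff, epoly_natDegree] at this
    constructor
    · rw [key]
      refine Polynomial.natDegree_add_le_of_degree_le ?_ ?_
      · refine (Polynomial.natDegree_C_mul_le _ _).trans ?_
        rw [epoly_natDegree]; simp
      · have := (ih P' hP').1
        omega
    · rw [key, Nat.add_sub_cancel, Polynomial.coeff_add, Polynomial.coeff_C_mul, hm, hP0]
      push_cast; ring

lemma dop_iter (α : ℝ) (d : ℕ) (P : ℝ[X]) (hP : P.natDegree = d) (hP0 : P ≠ 0)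
    (hα : ∀ k : ℕ, k ≤ d → α ≠ k) (t : ℕ) :
    (((dop α) ^ t) P).natDegree ≤ d - t ∧ (t ≤ d → (((dop α) ^ t) P).coeff (d - t) ≠ 0) ∧
      (d < t → ((dop α) ^ t) P = 0) := by
  induction t with
  | zero => 
    subst hP
    simp [hP0]
  | succ t ih =>
    obtain ⟨h1, h2, h3⟩ := ih
    rw [pow_succ', Module.End.mul_apply]
    have h := dop_deg α (d - t) _ h1
    rw [show d - t - 1 = d - (t + 1) by omega] at h
    refine ⟨h.1, fun htd => ?_, fun htd => ?_⟩
    · rw [h.2]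
      refine mul_ne_zero (mul_ne_zero ?_ ?_) (h2 (by omega))
      · exact_mod_cast (by omega : d - t ≠ 0)
      · exact sub_ne_zero.2 (hα _ (by omega))
    · rcases lt_or_ge d t with h' | h'
      · rw [h3 h', map_zero]
      · rw [Polynomial.eq_C_of_natDegree_le_zero (p := (dop α ^ t) P) (by omega), dop_C]

lemma phi_iter (α : ℝ) (φ : ℝ[X] →ₗ[ℝ] ℝ) (P : ℝ[X]) (hφ : ∀ k : ℕ, φ (laguerre α k) = P.eval (k : ℝ))
    (t : ℕ) : ∀ k : ℕ, t ≤ k → φ (X ^ t * laguerre α k) = (((dop α) ^ t) P).eval (k : ℝ) := by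
  induction t with
  | zero => intro k _; simp [hφ]
  | succ t ih =>
    intro k hk
    obtain ⟨k, rfl⟩ : ∃ k', k = k' + 1 := ⟨k - 1, by omega⟩
    rw [pow_succ, mul_assoc, lag_rec, pow_succ', Module.End.mul_apply, dop_eval]
    have : (X : ℝ[X]) ^ t * (C (-((k : ℝ) + 2)) * laguerre α (k + 2)
        + C (2 * (k : ℝ) + α + 3) * laguerre α (k + 1) - C ((k : ℝ) + 1 + α) * laguerre α k) =
        (-((k : ℝ) + 2)) • (X ^ t * laguerre α (k + 2))
        + (2 * (k : ℝ) + α + 3) • (X ^ t * laguerre α (k + 1))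
        - ((k : ℝ) + 1 + α) • (X ^ t * laguerre α k) := by
      simp only [Polynomial.smul_eq_C_mul]; ring
    rw [this, map_sub, map_add, map_smul, map_smul, map_smul, ih _ (by omega), ih _ (by omega),
      ih _ (by omega)]
    have e1 : ((k + 1 : ℕ) : ℝ) + 1 = ((k + 2 : ℕ) : ℝ) := by push_cast; ring
    have e2 : ((k + 1 : ℕ) : ℝ) - 1 = (k : ℝ) := by push_cast; ring
    rw [e1, e2]
    simp only [smul_eq_mul]
    push_cast
    ring

/-- Casorati matrix with an additional polynomial in the first row. -/
noncomputable def cmat {m : ℕ} (R : Fin m → ℝ[X]) (S : ℝ[X]) (n : ℤ) :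
    Matrix (Fin (m + 1)) (Fin (m + 1)) ℝ :=
  Matrix.of fun i j => (Fin.cons (α := fun _ => ℝ[X]) S R i).eval ((n : ℝ) - ((j : ℕ) : ℝ))

lemma psi_q (α : ℝ) {m : ℕ} (R : Fin m → ℝ[X]) (S : ℝ[X]) (ψ : ℝ[X] →ₗ[ℝ] ℝ) (N : ℕ)
    (hψ : ∀ k : ℕ, N ≤ k → ψ (laguerre α k) = S.eval (k : ℝ)) (n : ℤ) (hn : (N : ℤ) + m ≤ n) :
    ψ (qZ α R n) = (cmat R S n).det := by
  rw [qZ, if_neg (by omega), qpoly, Matrix.det_succ_row_zero, Matrix.det_succ_row_zero, map_sum]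
  apply Finset.sum_congr rfl
  intro j _
  have hsub : (Matrix.of fun i j : Fin (m + 1) =>
      if h : (i : ℕ) = 0 then laguerreZ α (n - (j : ℕ))
      else Polynomial.C ((R ⟨(i : ℕ) - 1, by have := i.isLt; omega⟩).eval
        ((n : ℝ) - ((j : ℕ) : ℝ)))).submatrix Fin.succ j.succAbove =
      (C : ℝ →+* ℝ[X]).mapMatrix ((cmat R S n).submatrix Fin.succ j.succAbove) := by
    ext1 a b
    simp [cmat]
  rw [hsub, ← RingHom.map_det]
  generalize ((cmat R S n).submatrix Fin.succ j.succAbove).det = D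
  have hj := j.isLt
  rw [Matrix.of_apply, dif_pos (Fin.val_zero _)]
  simp only [Matrix.of_apply, cmat, Fin.cons_zero]
  rw [laguerreZ, if_neg (by omega)]
  have : ((-1 : ℝ[X]) ^ (j : ℕ) * laguerre α (n - (j : ℕ)).toNat * C D) =
      ((-1 : ℝ) ^ (j : ℕ) * D) • laguerre α (n - (j : ℕ)).toNat := by
    rw [Polynomial.smul_eq_C_mul]; simp; ring
  rw [this, map_smul, hψ _ (by omega)]
  have hc : (((n - (j : ℕ)).toNat : ℕ) : ℝ) = (n : ℝ) - ((j : ℕ) : ℝ) := by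
    have : (((n - (j : ℕ)).toNat : ℕ) : ℤ) = n - (j : ℕ) := Int.toNat_of_nonneg (by omega)
    exact_mod_cast congrArg (Int.cast : ℤ → ℝ) this
  rw [hc, smul_eq_mul]; ring

/-- if the extended Casoratian vanishes eventually, `S` is in the span of the `R`. -/
lemma span_of_det {m : ℕ} (R : Fin m → ℝ[X]) (S : ℝ[X]) (hΩ : ∀ n : ℕ, casoratian R (n : ℝ) ≠ 0)
    (N : ℕ) (hdet : ∀ n : ℕ, N ≤ n → (cmat R S n).det = 0) :
    ∃ a : Fin m → ℝ, S = ∑ h, C (a h) * R h := by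
  have uniq : ∀ n : ℕ, ∀ a : Fin m → ℝ,
      (∀ j : Fin m, ∑ h, a h * (R h).eval ((n : ℝ) - ((j : ℕ) + 1)) = 0) → a = 0 := by
    intro n a ha
    by_contra hne
    apply hΩ n
    rw [casoratian, ← Matrix.exists_vecMul_eq_zero_iff]
    refine ⟨a, hne, ?_⟩
    ext j
    simpa [Matrix.vecMul, dotProduct] using ha j
  have ex : ∀ n : ℕ, N ≤ n → ∃ a : Fin m → ℝ, ∀ j : ℕ, j ≤ m →
      S.eval ((n : ℝ) - j) = ∑ h, a h * (R h).eval ((n : ℝ) - j) := by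
    intro n hn
    obtain ⟨w, hw, hw0⟩ := Matrix.exists_vecMul_eq_zero_iff.2 (hdet n hn)
    have hw1 : ∀ j : ℕ, j ≤ m →
        w 0 * S.eval ((n : ℝ) - j) + ∑ h : Fin m, w h.succ * (R h).eval ((n : ℝ) - j) = 0 := by
      intro j hj
      have := congrFun hw0 ⟨j, by omega⟩
      simpa [Matrix.vecMul, dotProduct, cmat, Fin.sum_univ_succ] using this
    have hne : w 0 ≠ 0 := by
      intro h0
      apply hw
      have h2 := uniq n (fun h => w h.succ) (by
        intro j
        have := hw1 (j + 1) (by omega)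
        rw [h0] at this
        push_cast at this
        simpa using this)
      ext i
      refine Fin.cases h0 (fun h => congrFun h2 h) i
    refine ⟨fun h => -(w h.succ / w 0), fun j hj => ?_⟩
    have := hw1 j hj
    have h3 : ∑ h : Fin m, -(w h.succ / w 0) * (R h).eval ((n : ℝ) - j) =
        -(∑ h : Fin m, w h.succ * (R h).eval ((n : ℝ) - j)) / w 0 := by
      rw [← Finset.sum_neg_distrib, Finset.sum_div]
      apply Finset.sum_congr rfl; intros; ring
    rw [h3, eq_div_iff hne]; linarith
  choose! a ha using ex
  have const : ∀ n : ℕ, N ≤ n → a n = a N := by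
    intro n hn
    induction n, hn using Nat.le_induction with
    | base => rfl
    | succ n hn ih =>
      rw [← ih, ← sub_eq_zero]
      apply uniq (n + 1)
      intro j
      have h1 := ha (n + 1) (by omega) (j + 1) (by omega)
      have h2 := ha n hn j (by omega)
      have e : ((n + 1 : ℕ) : ℝ) - ((j + 1 : ℕ) : ℝ) = (n : ℝ) - ((j : ℕ) : ℝ) := by push_cast; ring
      have e' : ((n + 1 : ℕ) : ℝ) - (((j : ℕ) : ℝ) + 1) = (n : ℝ) - ((j : ℕ) : ℝ) := by
        push_cast; ring
      rw [e] at h1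
      simp only [e', Pi.sub_apply, sub_mul, Finset.sum_sub_distrib]
      linarith
  refine ⟨a N, ?_⟩
  apply Polynomial.eq_of_infinite_eval_eq
  apply Set.Infinite.mono (s := (Nat.cast : ℕ → ℝ) '' Set.Ici N)
  · rintro _ ⟨n, hn, rfl⟩
    have := ha n hn 0 (by omega)
    simp only [Nat.cast_zero, sub_zero] at this
    simp [Polynomial.eval_finsetSum, this, const n hn]
  · exact (Set.Ici_infinite N).image Nat.cast_injective.injOn

lemma natDegree_span {m : ℕ} (g : Fin m → ℕ) (hg : StrictMono g) (R : Fin m → ℝ[X])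
    (hdeg : ∀ i, (R i).natDegree = g i) (hR0 : ∀ i, R i ≠ 0) (a : Fin m → ℝ) (d : ℕ) (hd : ∀ i, g i ≠ d)
    (hS : (∑ h, C (a h) * R h).natDegree = d) : ∑ h, C (a h) * R h = 0 := by
  by_contra hne
  have hex : (Finset.univ.filter fun h => a h ≠ 0).Nonempty := by
    by_contra hem
    apply hne
    rw [Finset.not_nonempty_iff_eq_empty, Finset.filter_eq_empty_iff] at hem
    apply Finset.sum_eq_zero
    intro h _
    have := hem (Finset.mem_univ h)
    simp only [ne_eq, not_not] at this
    simp [this]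
  set i := (Finset.univ.filter fun h => a h ≠ 0).max' hex with hi
  have hai : a i ≠ 0 := (Finset.mem_filter.1 (Finset.max'_mem _ hex)).2
  have hR := hR0 i
  have hlt : ∀ h, i < h → a h = 0 := by
    intro h hh
    by_contra hc
    exact absurd (Finset.le_max' (Finset.univ.filter fun h => a h ≠ 0) h (by simp [hc])) (not_le.2 hh)
  apply hd i
  rw [← hS]
  symm
  apply Polynomial.natDegree_eq_of_le_of_coeff_ne_zero
  · apply Polynomial.natDegree_sum_le_of_forall_le
    intro h _
    by_cases hh : i < h
    · simp [hlt h hh]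
    · refine (Polynomial.natDegree_C_mul_le _ _).trans ?_
      rw [hdeg]
      exact hg.monotone (not_lt.1 hh)
  · rw [Polynomial.finsetSum_coeff, Finset.sum_eq_single i]
    · rw [Polynomial.coeff_C_mul, ← hdeg i]
      exact mul_ne_zero hai (by simpa using hR)
    · intro h _ hne
      rw [Polynomial.coeff_C_mul]
      rcases lt_or_gt_of_ne hne with h1 | h1
      · rw [Polynomial.coeff_eq_zero_of_natDegree_lt (by rw [hdeg]; exact hg h1), mul_zero]
      · rw [hlt h h1, zero_mul]
    · simp

/-- if `Q(x) = Σ_{k=u}^v σ_k x^k` with `σ_u, σ_v ≠ 0` and there is `ĝ ∈ G` with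
`ĝ − u ≥ 0` and `ĝ − u ∉ G`, then `(q_n)_n` satisfies no recurrence `Q(x)·q_n = Σ_{i=s}^r γ_{n,i} q_{n+i}`
with `γ_{n,s}, γ_{n,r} ≠ 0` for all `n`. -/
theorem statement1 (α : ℝ) (m : ℕ) (hm : 0 < m) (g : Fin m → ℕ) (hg : StrictMono g)
    (hgpos : ∀ i, 0 < g i) (R : Fin m → Polynomial ℝ)
    (hdeg : ∀ i, (R i).natDegree = g i)
    (hlead : ∀ i, (R i).leadingCoeff = 1 / (Nat.factorial (g i) : ℝ))
    (hα : ∀ k : ℕ, α - (Gmax g : ℝ) ≠ -(k : ℝ))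
    (hΩ : ∀ n : ℕ, casoratian R (n : ℝ) ≠ 0)
    (u v : ℕ) (huv : u ≤ v) (σ : ℕ → ℝ) (hσu : σ u ≠ 0) (hσv : σ v ≠ 0)
    (i₀ : Fin m) (hi₀u : u ≤ g i₀) (hi₀ : ∀ i : Fin m, g i ≠ g i₀ - u) :
    ¬ ∃ (s r : ℤ), s ≤ r ∧ ∃ γ : ℕ → ℤ → ℝ,
        (∀ n : ℕ, γ n s ≠ 0 ∧ γ n r ≠ 0) ∧
        (∀ n : ℕ, -s ≤ (n : ℤ) →
          (∑ k ∈ Finset.Icc u v, Polynomial.C (σ k) * Polynomial.X ^ k) * qZ α R (n : ℤ) =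
            ∑ i ∈ Finset.Icc s r, Polynomial.C (γ n i) * qZ α R ((n : ℤ) + i)) := by
  rintro ⟨s, r, hsr, γ, -, hrec⟩
  have hR0 : ∀ i, R i ≠ 0 := by
    intro i h
    have := hdeg i
    rw [h, Polynomial.natDegree_zero] at this
    have := hgpos i
    omega
  have hα' : ∀ k : ℕ, k ≤ g i₀ → α ≠ k := by
    intro k hk h
    have hle : g i₀ ≤ Gmax g := Finset.le_sup (f := g) (Finset.mem_univ i₀)
    apply hα (Gmax g - k)
    rw [Nat.cast_sub (by omega), h]; ring
  obtain ⟨φ, hφ⟩ := exists_fun α (fun k => (R i₀).eval (k : ℝ))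
  set Q : ℝ[X] := ∑ k ∈ Finset.Icc u v, Polynomial.C (σ k) * Polynomial.X ^ k with hQ
  set S : ℝ[X] := ∑ k ∈ Finset.Icc u v, C (σ k) * ((dop α) ^ k) (R i₀) with hS
  have hdop := dop_iter α (g i₀) (R i₀) (hdeg i₀) (hR0 i₀) hα'
  have hScoeff : S.coeff (g i₀ - u) ≠ 0 := by
    rw [hS, Polynomial.finsetSum_coeff, Finset.sum_eq_single u]
    · rw [Polynomial.coeff_C_mul]
      exact mul_ne_zero hσu ((hdop u).2.1 hi₀u)
    · intro k hk hne
      rw [Finset.mem_Icc] at hk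
      rw [Polynomial.coeff_C_mul]
      rcases lt_or_ge (g i₀) k with h | h
      · rw [(hdop k).2.2 h]; simp
      · rw [Polynomial.coeff_eq_zero_of_natDegree_lt, mul_zero]
        have := (hdop k).1
        omega
    · intro h; exact absurd (Finset.mem_Icc.2 ⟨le_rfl, huv⟩) h
  have hSdeg : S.natDegree = g i₀ - u := by
    apply Polynomial.natDegree_eq_of_le_of_coeff_ne_zero _ hScoeff
    apply Polynomial.natDegree_sum_le_of_forall_le
    intro k hk
    rw [Finset.mem_Icc] at hk
    refine (Polynomial.natDegree_C_mul_le _ _).trans ?_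
    have := (hdop k).1
    omega
  set ψ : ℝ[X] →ₗ[ℝ] ℝ := φ.comp (LinearMap.mulLeft ℝ Q) with hψ
  have hψL : ∀ k : ℕ, v ≤ k → ψ (laguerre α k) = S.eval (k : ℝ) := by
    intro k hk
    rw [hψ, LinearMap.comp_apply, LinearMap.mulLeft_apply, hQ, hS, Finset.sum_mul, map_sum,
      Polynomial.eval_finsetSum]
    apply Finset.sum_congr rfl
    intro t ht
    rw [Finset.mem_Icc] at ht
    rw [mul_assoc, ← Polynomial.smul_eq_C_mul, map_smul,
      phi_iter α φ (R i₀) hφ t k (by omega), Polynomial.eval_mul, Polynomial.eval_C, smul_eq_mul]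
  have hdet : ∀ n : ℕ, v + m + s.natAbs ≤ n → (cmat R S n).det = 0 := by
    intro n hn
    rw [← psi_q α R S ψ v hψL n (by omega), hψ, LinearMap.comp_apply, LinearMap.mulLeft_apply,
      hrec n (by omega), map_sum]
    apply Finset.sum_eq_zero
    intro i hi
    rw [Finset.mem_Icc] at hi
    rw [← Polynomial.smul_eq_C_mul, map_smul,
      psi_q α R (R i₀) φ 0 (fun k _ => hφ k) (n + i) (by omega)]
    rw [Matrix.det_zero_of_row_eq (i := 0) (j := i₀.succ) (Fin.succ_ne_zero i₀).symm, smul_zero]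
    ext j
    simp [cmat]
  obtain ⟨a, ha⟩ := span_of_det R S hΩ _ hdet
  apply hScoeff
  rw [ha, natDegree_span g hg R hdeg hR0 a (g i₀ - u) hi₀ (ha ▸ hSdeg)]
  simp
end

section
/- Let α be a real number with α − max G ∉ {0, −1, −2, …}, assume Ω_G(n) ≠ 0 for every integer n ≥ 0, and let κ_i^g (i = 0,…,m−1, g ∈ G) be admissible. Then for every n ≥ 0 the polynomials (q_n)_n satisfy ⟨q_n, q_i⟩ = 0 for i = 0,…,n−1 and ⟨q_n, q_n⟩ ≠ 0, where ⟨·,·⟩ is the bilinear form defined below. -/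
open Polynomial Finset

/-- The moment functional as a linear map. -/
noncomputable def momL (β : ℝ) (k : ℤ) : Polynomial ℝ →ₗ[ℝ] ℝ :=
  Polynomial.lsum fun t => (Real.Gamma (β + t + k + 1)) • (LinearMap.id : ℝ →ₗ[ℝ] ℝ)

lemma momL_monomial (β : ℝ) (k : ℤ) (t : ℕ) (a : ℝ) :
    momL β k (monomial t a) = a * Real.Gamma (β + t + k + 1) := by
  simp [momL, Polynomial.lsum_apply, Polynomial.sum_monomial_index, mul_comm]

lemma momFun_eq (β : ℝ) (p : Polynomial ℝ) (k : ℤ) : momFun β p k = momL β k p := by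
  conv_rhs => rw [p.as_sum_range]
  rw [map_sum]
  simp [momFun, momL_monomial]

lemma momL_shift (α : ℝ) (m k : ℕ) (p : Polynomial ℝ) :
    momL (α - m) 0 (p * X ^ k) = momL α ((k : ℤ) - (m : ℤ)) p := by
  conv_lhs => rw [p.as_sum_range]
  conv_rhs => rw [p.as_sum_range]
  rw [Finset.sum_mul, map_sum, map_sum]
  refine Finset.sum_congr rfl fun t _ => ?_
  rw [monomial_mul_X_pow, momL_monomial, momL_monomial]
  congr 2
  push_cast
  ring

lemma poch_succ (a : ℝ) (l : ℕ) : poch a (l + 1) = poch a l * (a + l) := by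
  simp [poch, Finset.prod_range_succ]

lemma poch_succ' (a : ℝ) (l : ℕ) : poch a (l + 1) = a * poch (a + 1) l := by
  simp only [poch, Finset.prod_range_succ']
  rw [mul_comm]
  congr 1
  · simp
  · refine Finset.prod_congr rfl fun t _ => ?_
    push_cast
    ring

lemma poch_zero (a : ℝ) : poch a 0 = 1 := by simp [poch]

lemma gamma_poch (b : ℝ) (hb : ∀ t : ℕ, b ≠ -(t : ℝ)) (j : ℕ) :
    Real.Gamma (b + j) = poch b j * Real.Gamma b := by
  induction j with
  | zero => simp [poch_zero]
  | succ j ih =>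
    have h : b + j ≠ 0 := fun h => hb j (by linarith)
    have := Real.Gamma_add_one h
    push_cast
    rw [← add_assoc, this, ih, poch_succ]
    ring

lemma vander (u : ℕ) : ∀ a b : ℝ,
    ∑ j ∈ Finset.range (u + 1), (u.choose j : ℝ) *
      ((-1) ^ j * poch b j * poch (a + j + 1) (u - j)) = poch (a + 1 - b) u := by
  induction u with
  | zero => intro a b; simp [poch_zero]
  | succ u ih =>
    intro a b
    have h := Finset.sum_choose_succ_mul
      (fun i k => (-1 : ℝ) ^ i * poch b i * poch (a + i + 1) k) u
    rw [h]
    have e1 : ∑ i ∈ Finset.range (u + 1), (u.choose i : ℝ) *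
        ((-1) ^ i * poch b i * poch (a + i + 1) (u + 1 - i))
        = (a + u + 1) * poch (a + 1 - b) u := by
      rw [← ih a b, Finset.mul_sum]
      refine Finset.sum_congr rfl fun i hi => ?_
      have hi' : i ≤ u := by simpa [Nat.lt_succ_iff] using hi
      rw [Nat.sub_add_comm hi', poch_succ, Nat.cast_sub hi']
      ring
    have e2 : ∑ i ∈ Finset.range (u + 1), (u.choose i : ℝ) *
        ((-1) ^ (i + 1) * poch b (i + 1) * poch (a + ((i + 1 : ℕ) : ℝ) + 1) (u - i))
        = - b * poch (a + 1 - b) u := by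
      have := ih (a + 1) (b + 1)
      rw [show a + 1 + 1 - (b + 1) = a + 1 - b by ring] at this
      rw [← this, Finset.mul_sum]
      refine Finset.sum_congr rfl fun i hi => ?_
      rw [poch_succ', show a + ((i + 1 : ℕ) : ℝ) + 1 = a + 1 + i + 1 by push_cast; ring]
      ring
    rw [poch_succ]
    refine (congrArg₂ (· + ·) e1 e2).trans ?_
    ring

lemma genBinom_eq (α : ℝ) (u j : ℕ) :
    genBinom α u j = poch (α + j + 1) (u - j) / (Nat.factorial (u - j) : ℝ) := by
  rw [genBinom, Finset.prod_Ico_eq_prod_range, poch, Nat.add_sub_add_right]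
  congr 1
  refine Finset.prod_congr rfl fun t _ => ?_
  push_cast
  ring

lemma momL_laguerre (α : ℝ) (s : ℤ) (u : ℕ) (hb : ∀ t : ℕ, α + s + 1 ≠ -(t : ℝ)) :
    momL α s (laguerre α u)
      = Real.Gamma (α + s + 1) * poch (-(s : ℝ)) u / (Nat.factorial u : ℝ) := by
  have hv := vander u α (α + s + 1)
  rw [show α + 1 - (α + s + 1) = -(s : ℝ) by ring] at hv
  rw [← hv, laguerre, map_sum, Finset.mul_sum, Finset.sum_div]
  refine Finset.sum_congr rfl fun j hj => ?_
  have hj' : j ≤ u := by simpa [Nat.lt_succ_iff] using hj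
  rw [C_mul_X_pow_eq_monomial, momL_monomial, genBinom_eq,
    show α + j + s + 1 = α + s + 1 + j by ring, gamma_poch _ hb, Nat.cast_choose ℝ hj']
  have h1 : (Nat.factorial u : ℝ) ≠ 0 := by positivity
  have h2 : (Nat.factorial j : ℝ) ≠ 0 := by positivity
  have h3 : (Nat.factorial (u - j) : ℝ) ≠ 0 := by positivity
  field_simp

lemma poch_fact (l u : ℕ) :
    poch ((l : ℝ) + 1) u * (Nat.factorial l : ℝ) = (Nat.factorial (l + u) : ℝ) := by
  induction u with
  | zero => simp [poch_zero]
  | succ u ih =>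
    rw [poch_succ, ← add_assoc, Nat.factorial_succ]
    push_cast
    rw [← ih]
    ring

lemma binomPoly_eval (l u : ℕ) :
    (binomPoly l).eval (u : ℝ) = poch ((l : ℝ) + 1) u / (Nat.factorial u : ℝ) := by
  have h1 : (binomPoly l).eval (u : ℝ) = (Nat.factorial l : ℝ)⁻¹ * poch ((u : ℝ) + 1) l := by
    simp only [binomPoly, eval_mul, eval_C, eval_prod, eval_add, eval_X, poch]
    congr 1
    refine Finset.prod_congr rfl fun t _ => ?_
    ring
  have h2 : (Nat.factorial l : ℝ) ≠ 0 := by positivity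
  have h3 : (Nat.factorial u : ℝ) ≠ 0 := by positivity
  have h4 := poch_fact l u
  have h5 := poch_fact u l
  rw [add_comm l u, ← h5] at h4
  rw [h1]
  field_simp
  linarith

/-- The functional `Λ_h`. -/
noncomputable def lam (α : ℝ) (N : ℕ) (w : ℕ → ℝ) : Polynomial ℝ →ₗ[ℝ] ℝ :=
  ∑ l ∈ Finset.range (N + 1), (poch (α - l) l * w l) • momL α (-((l : ℤ) + 1))

lemma lam_laguerre (α : ℝ) (N : ℕ) (w : ℕ → ℝ) (hα : ∀ k : ℕ, α - (N : ℝ) ≠ -(k : ℝ)) (u : ℕ) :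
    lam α N w (laguerre α u) = Real.Gamma α *
      (∑ l ∈ Finset.range (N + 1), Polynomial.C (w l) * binomPoly l).eval (u : ℝ) := by
  rw [eval_finsetSum, Finset.mul_sum, lam, LinearMap.sum_apply]
  refine Finset.sum_congr rfl fun l hl => ?_
  have hl' : l ≤ N := by simpa [Nat.lt_succ_iff] using hl
  have e : α + ((-((l : ℤ) + 1) : ℤ) : ℝ) + 1 = α - l := by push_cast; ring
  have hb : ∀ t : ℕ, α - l ≠ -(t : ℝ) := by
    intro t ht
    apply hα (t + (N - l))
    push_cast [Nat.cast_sub hl']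
    linarith
  have hG := gamma_poch (α - l) hb l
  rw [sub_add_cancel] at hG
  rw [LinearMap.smul_apply, momL_laguerre _ _ _ (by rw [e]; exact hb), e, eval_mul, eval_C,
    binomPoly_eval, hG, smul_eq_mul]
  push_cast
  rw [neg_neg]
  ring

/-- The coefficients of `q_n` in terms of Laguerre polynomials. -/
noncomputable def qc {m : ℕ} (R : Fin m → Polynomial ℝ) (n : ℕ) (j : Fin (m + 1)) : ℝ :=
  (-1) ^ (j : ℕ) *
    Matrix.det (Matrix.of fun i k : Fin m => (R i).eval ((n : ℝ) - ((j.succAbove k : ℕ) : ℝ)))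

lemma qpoly_eq (α : ℝ) {m : ℕ} (R : Fin m → Polynomial ℝ) (n : ℕ) :
    qpoly α R (n : ℤ) = ∑ j : Fin (m + 1), qc R n j • laguerreZ α ((n : ℤ) - (j : ℕ)) := by
  rw [qpoly, Matrix.det_succ_row_zero]
  refine Finset.sum_congr rfl fun j _ => ?_
  have : (Matrix.submatrix (Matrix.of fun i j : Fin (m + 1) =>
      if h : (i : ℕ) = 0 then laguerreZ α ((n : ℤ) - (j : ℕ))
      else Polynomial.C ((R ⟨(i : ℕ) - 1, by have := i.isLt; omega⟩).eval
        (((n : ℤ) : ℝ) - ((j : ℕ) : ℝ)))) Fin.succ j.succAbove)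
      = (Polynomial.C : ℝ →+* Polynomial ℝ).mapMatrix
        (Matrix.of fun i k : Fin m => (R i).eval ((n : ℝ) - ((j.succAbove k : ℕ) : ℝ))) := by
    ext1 i k
    simp
  rw [this, ← RingHom.map_det, smul_eq_C_mul, qc]
  simp
  ring

lemma qc_sum {m : ℕ} (R : Fin m → Polynomial ℝ) (n : ℕ) (h : Fin m) :
    ∑ j : Fin (m + 1), qc R n j * (R h).eval ((n : ℝ) - ((j : ℕ) : ℝ)) = 0 := by
  let A : Matrix (Fin (m + 1)) (Fin (m + 1)) ℝ := Matrix.of fun i j =>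
    (Fin.cons (R h) R : Fin (m + 1) → Polynomial ℝ) i |>.eval ((n : ℝ) - ((j : ℕ) : ℝ))
  have hA : A.det = 0 := by
    refine Matrix.det_zero_of_row_eq (i := 0) (j := h.succ) (Fin.succ_ne_zero h).symm ?_
    ext j
    simp [A]
  rw [← hA, Matrix.det_succ_row_zero]
  refine Finset.sum_congr rfl fun j _ => ?_
  have : A.submatrix Fin.succ j.succAbove =
      Matrix.of fun i k : Fin m => (R i).eval ((n : ℝ) - ((j.succAbove k : ℕ) : ℝ)) := by
    ext i k
    simp [A]
  rw [this, qc]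
  simp only [A, Matrix.of_apply, Fin.cons_zero]
  ring

lemma qc_zero {m : ℕ} (R : Fin m → Polynomial ℝ) (n : ℕ) :
    qc R n 0 = casoratian R (n : ℝ) := by
  simp [qc, casoratian]

lemma qc_last {m : ℕ} (R : Fin m → Polynomial ℝ) (n : ℕ) :
    qc R n (Fin.last m) = (-1) ^ m * casoratian R ((n + 1 : ℕ) : ℝ) := by
  simp [qc, casoratian]

lemma laguerre_degree (α : ℝ) (u k : ℕ) (h : u < k) : (laguerre α u).coeff k = 0 := by
  rw [laguerre, finsetSum_coeff]
  refine Finset.sum_eq_zero fun j hj => ?_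
  rw [coeff_C_mul_X_pow, if_neg]
  simp at hj
  omega

lemma laguerre_lead (α : ℝ) (u : ℕ) :
    (laguerre α u).coeff u = (-1) ^ u / (Nat.factorial u : ℝ) := by
  rw [laguerre, finsetSum_coeff, Finset.sum_eq_single u]
  · rw [coeff_C_mul_X_pow, if_pos rfl, genBinom_eq]
    simp [poch_zero]
  · intro j _ hj
    rw [coeff_C_mul_X_pow, if_neg hj.symm]
  · simp

lemma laguerreZ_coeff (α : ℝ) (n j k : ℕ) (h : n < k + j) :
    (laguerreZ α ((n : ℤ) - (j : ℕ))).coeff k = 0 := by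
  rw [laguerreZ]
  split_ifs with h1
  · simp
  · apply laguerre_degree
    omega

lemma qpoly_coeff (α : ℝ) {m : ℕ} (R : Fin m → Polynomial ℝ) (n k : ℕ) (h : n < k) :
    (qpoly α R (n : ℤ)).coeff k = 0 := by
  rw [qpoly_eq, finsetSum_coeff]
  refine Finset.sum_eq_zero fun j _ => ?_
  rw [coeff_smul, laguerreZ_coeff _ _ _ _ (by omega), smul_zero]

lemma qpoly_lead (α : ℝ) {m : ℕ} (R : Fin m → Polynomial ℝ) (n : ℕ) :
    (qpoly α R (n : ℤ)).coeff n
      = casoratian R (n : ℝ) * ((-1) ^ n / (Nat.factorial n : ℝ)) := by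
  rw [qpoly_eq, finsetSum_coeff, Finset.sum_eq_single 0]
  · rw [coeff_smul, qc_zero, laguerreZ]
    rw [if_neg (by simp)]
    simp [laguerre_lead]
  · intro j _ hj
    have : (j : ℕ) ≠ 0 := fun h => hj (Fin.ext h)
    rw [coeff_smul, laguerreZ_coeff _ _ _ _ (by omega), smul_zero]
  · simp

/-- `⟨p, x^k⟩`. -/
noncomputable def bil (α : ℝ) {m : ℕ} (g : Fin m → ℕ) (κ : ℕ → Fin m → ℝ)
    (w : Fin m → ℕ → ℝ) (p : Polynomial ℝ) (k : ℕ) : ℝ :=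
  if k < m then ∑ h : Fin m, κ k h * lam α (g h) (w h) p
  else momL α ((k : ℤ) - (m : ℤ)) p

lemma bilin_eq (α : ℝ) {m : ℕ} (hm : 0 < m) (g : Fin m → ℕ) (κ : ℕ → Fin m → ℝ)
    (w : Fin m → ℕ → ℝ) (p q : Polynomial ℝ) (N : ℕ) (hN : q.natDegree < N) (hNm : m ≤ N) :
    bilin α g κ w p q = ∑ k ∈ Finset.range N, q.coeff k * bil α g κ w p k := by
  have hm' : (m : ℝ) ≠ 0 := by positivity
  have h1 : momFun (α - m) (p * q) 0
      = ∑ k ∈ Finset.range N, q.coeff k * momL α ((k : ℤ) - (m : ℤ)) p := by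
    rw [momFun_eq]
    conv_lhs => rw [q.as_sum_range' N hN]
    rw [Finset.mul_sum, map_sum]
    refine Finset.sum_congr rfl fun k _ => ?_
    rw [← momL_shift, ← C_mul_X_pow_eq_monomial, mul_left_comm, ← smul_eq_C_mul, map_smul,
      smul_eq_mul]
  have h2 : ∀ i ∈ Finset.range m,
      (Polynomial.eval 0 (Polynomial.derivative^[i] q) / (Nat.factorial i : ℝ)) *
        (∑ h : Fin m,
          (-(1 / (m : ℝ)) * momFun α p ((i : ℤ) - (m : ℤ)) +
            κ i h * ∑ l ∈ Finset.range (g h + 1),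
              poch (α - l) l * w h l * momFun α p (-((l : ℤ) + 1))))
      = q.coeff i * (bil α g κ w p i - momL α ((i : ℤ) - (m : ℤ)) p) := by
    intro i hi
    have hi' : i < m := by simpa using hi
    have hf : (Nat.factorial i : ℝ) ≠ 0 := by positivity
    have hc : Polynomial.eval 0 (Polynomial.derivative^[i] q) / (Nat.factorial i : ℝ)
        = q.coeff i := by
      rw [← coeff_zero_eq_eval_zero, coeff_iterate_derivative]
      simp [Nat.descFactorial_self]
      field_simp
    rw [hc, bil, if_pos hi', Finset.sum_add_distrib]
    simp only [momFun_eq, lam, LinearMap.sum_apply, LinearMap.smul_apply, smul_eq_mul,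
      Finset.sum_const, Finset.card_univ, Fintype.card_fin, nsmul_eq_mul]
    field_simp
    ring
  rw [bilin, h1, Finset.sum_congr rfl h2]
  have h3 : ∑ i ∈ Finset.range m, q.coeff i * (bil α g κ w p i - momL α ((i : ℤ) - (m : ℤ)) p)
      = ∑ i ∈ Finset.range N, q.coeff i * (bil α g κ w p i - momL α ((i : ℤ) - (m : ℤ)) p) := by
    refine Finset.sum_subset (Finset.range_mono hNm) fun i _ hi => ?_
    have : ¬ i < m := by simpa using hi
    rw [bil, if_neg this]
    ring
  rw [h3, ← Finset.sum_add_distrib]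
  refine Finset.sum_congr rfl fun i _ => ?_
  ring

lemma poch_neg_nat (s u : ℕ) (h : s < u) : poch (-(s : ℝ)) u = 0 := by
  rw [poch]
  exact Finset.prod_eq_zero (Finset.mem_range.mpr h) (by ring)

lemma poch_neg_self (s : ℕ) : poch (-(s : ℝ)) s ≠ 0 := by
  rw [poch]
  refine Finset.prod_ne_zero_iff.mpr fun t ht => ?_
  have : (t : ℝ) < s := by exact_mod_cast Finset.mem_range.mp ht
  linarith

lemma le_Gmax {m : ℕ} (g : Fin m → ℕ) (h : Fin m) : g h ≤ Gmax g :=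
  Finset.le_sup (f := g) (Finset.mem_univ h)

lemma bil_high (α : ℝ) {m : ℕ} (R : Fin m → Polynomial ℝ)
    (hα : ∀ k : ℕ, α ≠ -(k : ℝ)) (n s : ℕ) :
    momL α (s : ℤ) (qpoly α R (n : ℤ)) = ∑ j : Fin (m + 1), qc R n j *
      (if n < (j : ℕ) then 0 else
        Real.Gamma (α + s + 1) * poch (-(s : ℝ)) (n - j) / (Nat.factorial (n - j) : ℝ)) := by
  rw [qpoly_eq, map_sum]
  refine Finset.sum_congr rfl fun j _ => ?_
  rw [map_smul, smul_eq_mul, laguerreZ]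
  congr 1
  by_cases h : n < (j : ℕ)
  · rw [if_pos h, if_pos (by omega), map_zero]
  · rw [if_neg h, if_neg (by omega), momL_laguerre, show ((n : ℤ) - (j : ℕ)).toNat = n - j by omega]
    · push_cast
      rfl
    · intro t ht
      apply hα (t + s + 1)
      push_cast at ht ⊢
      linarith

lemma lam_q (α : ℝ) {m : ℕ} (R : Fin m → Polynomial ℝ) (N : ℕ) (w : ℕ → ℝ) (h : Fin m)
    (hα : ∀ k : ℕ, α - (N : ℝ) ≠ -(k : ℝ))
    (hw : R h = ∑ l ∈ Finset.range (N + 1), Polynomial.C (w l) * binomPoly l) (n : ℕ) :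
    lam α N w (qpoly α R (n : ℤ)) = ∑ j : Fin (m + 1), -(Real.Gamma α) * (qc R n j *
      (if n < (j : ℕ) then (R h).eval ((n : ℝ) - ((j : ℕ) : ℝ)) else 0)) := by
  have hs := congrArg (fun x => Real.Gamma α * x) (qc_sum R n h)
  simp only [mul_zero, Finset.mul_sum] at hs
  rw [← sub_eq_zero, qpoly_eq, map_sum, ← Finset.sum_sub_distrib]
  refine Eq.trans ?_ hs
  refine Finset.sum_congr rfl fun j _ => ?_
  rw [map_smul, smul_eq_mul, laguerreZ]
  by_cases hj : n < (j : ℕ)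
  · rw [if_pos hj, if_pos (by omega), map_zero]
    ring
  · rw [if_neg hj, if_neg (by omega), lam_laguerre _ _ _ hα, ← hw,
      show ((n : ℤ) - (j : ℕ)).toNat = n - j by omega, Nat.cast_sub (by omega)]
    ring

lemma bil_low (α : ℝ) {m : ℕ} (g : Fin m → ℕ) (R : Fin m → Polynomial ℝ)
    (hα : ∀ k : ℕ, α - (Gmax g : ℝ) ≠ -(k : ℝ)) (w : Fin m → ℕ → ℝ)
    (hw : ∀ h : Fin m, R h = ∑ l ∈ Finset.range (g h + 1), Polynomial.C (w h l) * binomPoly l)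
    (κ : Fin m → ℝ) (n : ℕ) :
    ∑ h : Fin m, κ h * lam α (g h) (w h) (qpoly α R (n : ℤ))
      = ∑ j : Fin (m + 1), -(Real.Gamma α) * (qc R n j *
      (if n < (j : ℕ) then ∑ h : Fin m, κ h * (R h).eval ((n : ℝ) - ((j : ℕ) : ℝ)) else 0)) := by
  have h1 : ∀ h ∈ (Finset.univ : Finset (Fin m)), κ h * lam α (g h) (w h) (qpoly α R (n : ℤ)) =
      ∑ j : Fin (m + 1), κ h * (-(Real.Gamma α) * (qc R n j *
      (if n < (j : ℕ) then (R h).eval ((n : ℝ) - ((j : ℕ) : ℝ)) else 0))) := by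
    intro h _
    rw [lam_q α R (g h) (w h) h _ (hw h), Finset.mul_sum]
    intro k hk
    apply hα (k + (Gmax g - g h))
    push_cast [Nat.cast_sub (le_Gmax g h)]
    linarith
  rw [Finset.sum_congr rfl h1, Finset.sum_comm]
  refine Finset.sum_congr rfl fun j _ => ?_
  split_ifs
  · rw [Finset.mul_sum, Finset.mul_sum]
    refine Finset.sum_congr rfl fun h _ => ?_
    ring
  · simp

/-- with admissible `κ_i^g`, the polynomials `(q_n)_n` satisfy
`⟨q_n, q_i⟩ = 0` for `i = 0,…,n−1` and `⟨q_n, q_n⟩ ≠ 0`. -/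
theorem statement5 (α : ℝ) (m : ℕ) (hm : 0 < m) (g : Fin m → ℕ) (hg : StrictMono g)
    (hgpos : ∀ i, 0 < g i) (R : Fin m → Polynomial ℝ)
    (hdeg : ∀ i, (R i).natDegree = g i)
    (hlead : ∀ i, (R i).leadingCoeff = 1 / (Nat.factorial (g i) : ℝ))
    (hα : ∀ k : ℕ, α - (Gmax g : ℝ) ≠ -(k : ℝ))
    (hΩ : ∀ n : ℕ, casoratian R (n : ℝ) ≠ 0)
    (w : Fin m → ℕ → ℝ)
    (hw : ∀ h : Fin m, R h = ∑ l ∈ Finset.range (g h + 1), Polynomial.C (w h l) * binomPoly l)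
    (κ : ℕ → Fin m → ℝ)
    (hκ : ∀ i : ℕ, i < m →
      (∀ j : ℕ, 1 ≤ j → j + i + 1 ≤ m → ∑ h : Fin m, κ i h * (R h).eval (-(j : ℝ)) = 0) ∧
        ∑ h : Fin m, κ i h * (R h).eval (-(m : ℝ) + (i : ℝ)) ≠ 0) :
    ∀ n : ℕ,
      (∀ i : ℕ, i < n → bilin α g κ w (qpoly α R (n : ℤ)) (qpoly α R (i : ℤ)) = 0) ∧
        bilin α g κ w (qpoly α R (n : ℤ)) (qpoly α R (n : ℤ)) ≠ 0 := by
  have hα0 : ∀ k : ℕ, α ≠ -(k : ℝ) := by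
    intro k hk
    apply hα (k + Gmax g)
    push_cast
    linarith
  have hΓ : ∀ s : ℕ, Real.Gamma (α + s) ≠ 0 := by
    intro s
    apply Real.Gamma_ne_zero
    intro k hk
    apply hα0 (k + s)
    push_cast
    linarith
  have hΓ0 : Real.Gamma α ≠ 0 := by simpa using hΓ 0
  have hlast : ∀ n : ℕ, qc R n (Fin.last m) ≠ 0 := by
    intro n
    rw [qc_last]
    exact mul_ne_zero (pow_ne_zero _ (by norm_num)) (hΩ (n + 1))
  have key0 : ∀ n k : ℕ, k < n → bil α g κ w (qpoly α R (n : ℤ)) k = 0 := by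
    intro n k hk
    rw [bil]
    split_ifs with hkm
    · rw [bil_low α g R hα w hw]
      refine Finset.sum_eq_zero fun j _ => ?_
      split_ifs with hj
      · have := (hκ k hkm).1 ((j : ℕ) - n) (by omega) (by omega)
        rw [Nat.cast_sub hj.le, neg_sub] at this
        rw [this]
        ring
      · ring
    · obtain ⟨s, rfl⟩ := Nat.exists_eq_add_of_le (not_lt.mp hkm)
      rw [show ((m + s : ℕ) : ℤ) - (m : ℤ) = (s : ℤ) by push_cast; ring, bil_high α R hα0]
      refine Finset.sum_eq_zero fun j _ => ?_
      rw [if_neg (by omega), poch_neg_nat _ _ (by omega)]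
      simp
  have key1 : ∀ n : ℕ, bil α g κ w (qpoly α R (n : ℤ)) n ≠ 0 := by
    intro n
    rw [bil]
    split_ifs with hkm
    · rw [bil_low α g R hα w hw, Finset.sum_eq_single (Fin.last m)]
      · have := (hκ n hkm).2
        rw [if_pos (by simpa using hkm)]
        refine mul_ne_zero (neg_ne_zero.mpr hΓ0) (mul_ne_zero (hlast n) ?_)
        rw [Fin.val_last, show (n : ℝ) - (m : ℝ) = -(m : ℝ) + n by ring]
        exact this
      · intro j _ hj
        have hj2 : (j : ℕ) ≠ m := fun h => hj (Fin.ext h)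
        split_ifs with hj1
        · have := (hκ n hkm).1 ((j : ℕ) - n) (by omega) (by omega)
          rw [Nat.cast_sub hj1.le, neg_sub] at this
          rw [this]
          ring
        · ring
      · simp
    · obtain ⟨s, rfl⟩ := Nat.exists_eq_add_of_le (not_lt.mp hkm)
      rw [show ((m + s : ℕ) : ℤ) - (m : ℤ) = (s : ℤ) by push_cast; ring, bil_high α R hα0,
        Finset.sum_eq_single (Fin.last m)]
      · rw [if_neg (by simp), Fin.val_last, Nat.add_sub_cancel_left]
        refine mul_ne_zero (hlast _) (div_ne_zero (mul_ne_zero ?_ (poch_neg_self s))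
          (by positivity))
        have := hΓ (s + 1)
        push_cast at this
        rwa [← add_assoc] at this
      · intro j _ hj
        have hj2 : (j : ℕ) ≠ m := fun h => hj (Fin.ext h)
        rw [if_neg (by omega), poch_neg_nat _ _ (by omega)]
        simp
      · simp
  have hdegq : ∀ i : ℕ, (qpoly α R (i : ℤ)).natDegree < i + m + 1 := by
    intro i
    have : (qpoly α R (i : ℤ)).natDegree ≤ i :=
      natDegree_le_iff_coeff_eq_zero.mpr fun k hk => qpoly_coeff α R i k hk
    omega
  intro n
  constructor
  · intro i hi
    rw [bilin_eq α hm g κ w _ _ (i + m + 1) (hdegq i) (by omega)]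
    refine Finset.sum_eq_zero fun k _ => ?_
    rcases lt_or_ge i k with h | h
    · rw [qpoly_coeff α R i k h, zero_mul]
    · rw [key0 n k (by omega), mul_zero]
  · rw [bilin_eq α hm g κ w _ _ (n + m + 1) (hdegq n) (by omega), Finset.sum_eq_single n]
    · refine mul_ne_zero ?_ (key1 n)
      rw [qpoly_lead]
      exact mul_ne_zero (hΩ n) (div_ne_zero (pow_ne_zero _ (by norm_num)) (by positivity))
    · intro k _ hk
      rcases lt_or_gt_of_ne hk with h | h
      · rw [key0 n k h, mul_zero]
      · rw [qpoly_coeff α R n k h, zero_mul]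
    · intro h
      exact absurd (Finset.mem_range.mpr (by omega)) h
end
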